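/- The satisfiability problem for CCTLb is decidable: with respect to a natural encoding of CCTLb formulas into ℕ, the predicate 'there exist a finite Kripke structure S and a state q of S such that q ⊨_S Φ' is computable. (The paper sharpens this to 2-EXPTIME-completeness.) -/

import Mathlib

open scoped Classical

noncomputable section

/-- A Kripke structure over atomic propositions indexed by `ℕ`. -/
structure Kripke (Q : Type) where
  R : Q → Q → Prop
  total : ∀ q, ∃ q', R q q'
  label : Q → ℕ → Prop

/-- An (infinite) run of a Kripke structure. -/
def Kripke.Run {Q : Type} (S : Kripke Q) (ρ : ℕ → Q) : Prop :=
  ∀ i, S.R (ρ i) (ρ (i + 1))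

/-- The strict prefix `ρ(0) ⋯ ρ(n-1)` of a run (`n` states). -/
def runPrefix {Q : Type} (ρ : ℕ → Q) (n : ℕ) : List Q :=
  (List.range n).map ρ

/-- The number of states of a finite prefix satisfying a predicate. -/
def countSat {Q : Type} (p : Q → Prop) : List Q → ℕ
  | [] => 0
  | s :: t => (if p s then 1 else 0) + countSat p t

/-- Comparison operators `<, ≤, =, ≥, >`. -/
inductive Cmp where
  | lt | le | eq | ge | gt

def Cmp.eval : Cmp → ℕ → ℕ → Prop
  | .lt, a, b => a < b
  | .le, a, b => a ≤ b
  | .eq, a, b => a = b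
  | .ge, a, b => a ≥ b
  | .gt, a, b => a > b

mutual
/-- CCTLb formulas. -/
inductive CForm : Type where
  | atom : ℕ → CForm
  | and : CForm → CForm → CForm
  | not : CForm → CForm
  | eu : CForm → Constr → CForm → CForm
  | au : CForm → Constr → CForm → CForm

/-- Linear expressions `Σᵢ αᵢ·#φᵢ` with natural coefficients. -/
inductive LinExp : Type where
  | term : ℕ → CForm → LinExp
  | add : LinExp → LinExp → LinExp

/-- Boolean combinations of atomic constraints `(Σᵢ αᵢ·#φᵢ) ∼ k`. -/
inductive Constr : Type where
  | atomic : LinExp → Cmp → ℕ → Constr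
  | cand : Constr → Constr → Constr
  | cnot : Constr → Constr
end

mutual
/-- Satisfaction of a CCTLb formula at a state. -/
def sat {Q : Type} (S : Kripke Q) : CForm → Q → Prop
  | .atom p, q => S.label q p
  | .and φ ψ, q => sat S φ q ∧ sat S ψ q
  | .not φ, q => ¬ sat S φ q
  | .eu φ C ψ, q => ∃ ρ, S.Run ρ ∧ ρ 0 = q ∧
      ∃ i, sat S ψ (ρ i) ∧ csat S C (runPrefix ρ i) ∧ ∀ j < i, sat S φ (ρ j)
  | .au φ C ψ, q => ∀ ρ, S.Run ρ → ρ 0 = q →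
      ∃ i, sat S ψ (ρ i) ∧ csat S C (runPrefix ρ i) ∧ ∀ j < i, sat S φ (ρ j)
termination_by φ _ => sizeOf φ

def lval {Q : Type} (S : Kripke Q) : LinExp → List Q → ℕ
  | .term a φ, σ => a * countSat (fun s => sat S φ s) σ
  | .add e f, σ => lval S e σ + lval S f σ
termination_by e _ => sizeOf e

def csat {Q : Type} (S : Kripke Q) : Constr → List Q → Prop
  | .atomic e c k, σ => c.eval (lval S e σ) k
  | .cand C D, σ => csat S C σ ∧ csat S D σ
  | .cnot C, σ => ¬ csat S C σ
termination_by C _ => sizeOf C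
end

mutual
/-- A natural (Gödel) encoding of formulas as natural numbers. -/
def encForm : CForm → ℕ
  | .atom p => Nat.pair 0 p
  | .and φ ψ => Nat.pair 1 (Nat.pair (encForm φ) (encForm ψ))
  | .not φ => Nat.pair 2 (encForm φ)
  | .eu φ C ψ => Nat.pair 3 (Nat.pair (encForm φ) (Nat.pair (encConstr C) (encForm ψ)))
  | .au φ C ψ => Nat.pair 4 (Nat.pair (encForm φ) (Nat.pair (encConstr C) (encForm ψ)))

def encLin : LinExp → ℕ
  | .term a φ => Nat.pair 0 (Nat.pair a (encForm φ))
  | .add e f => Nat.pair 1 (Nat.pair (encLin e) (encLin f))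

def encConstr : Constr → ℕ
  | .atomic e c k =>
      Nat.pair 0 (Nat.pair (encLin e)
        (Nat.pair (match c with | .lt => 0 | .le => 1 | .eq => 2 | .ge => 3 | .gt => 4) k))
  | .cand C D => Nat.pair 1 (Nat.pair (encConstr C) (encConstr D))
  | .cnot C => Nat.pair 2 (encConstr C)
end

/-- A finite presentation of a Kripke structure. -/
structure FinKS where
  n : ℕ
  edges : List (ℕ × ℕ)
  labels : List (ℕ × ℕ)

/-- Totality of the presented transition relation. -/
def FinKS.Total (M : FinKS) : Prop :=
  ∀ q : Fin M.n, ∃ q' : Fin M.n, ((q : ℕ), (q' : ℕ)) ∈ M.edges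

/-- The Kripke structure presented by `M`. -/
def FinKS.toKripke (M : FinKS) (h : M.Total) : Kripke (Fin M.n) where
  R a b := ((a : ℕ), (b : ℕ)) ∈ M.edges
  total := h
  label a p := ((a : ℕ), p) ∈ M.labels

/-! ### Reading natural numbers as formulas -/

theorem unpair_snd_lt {n : ℕ} (h : n.unpair.1 ≠ 0) : n.unpair.2 < n := by
  conv_rhs => rw [← Nat.pair_unpair n]
  exact (Nat.right_le_pair 0 _).trans_lt (Nat.pair_lt_pair_left _ (Nat.pos_of_ne_zero h))

theorem unpair_snd_fst_lt {n : ℕ} (h : n.unpair.1 ≠ 0) : n.unpair.2.unpair.1 < n :=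
  (Nat.unpair_left_le _).trans_lt (unpair_snd_lt h)

theorem unpair_snd_snd_lt {n : ℕ} (h : n.unpair.1 ≠ 0) : n.unpair.2.unpair.2 < n :=
  (Nat.unpair_right_le _).trans_lt (unpair_snd_lt h)

theorem unpair_snd_fst_le (n : ℕ) : n.unpair.2.unpair.1 ≤ n :=
  (Nat.unpair_left_le _).trans (Nat.unpair_right_le _)

theorem unpair_snd_snd_le (n : ℕ) : n.unpair.2.unpair.2 ≤ n :=
  (Nat.unpair_right_le _).trans (Nat.unpair_right_le _)

theorem pair_le_pair {a b c d : ℕ} (h : a ≤ c) (h' : b ≤ d) : Nat.pair a b ≤ Nat.pair c d := by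
  have h1 : Nat.pair a b ≤ Nat.pair c b := by
    rcases h.eq_or_lt with rfl | h
    · rfl
    · exact (Nat.pair_lt_pair_left _ h).le
  have h2 : Nat.pair c b ≤ Nat.pair c d := by
    rcases h'.eq_or_lt with rfl | h
    · rfl
    · exact (Nat.pair_lt_pair_right _ h).le
  exact h1.trans h2

/-- The comparison operator with a given code. -/
def decCmp : ℕ → Cmp
  | 0 => .lt
  | 1 => .le
  | 2 => .eq
  | 3 => .ge
  | _ => .gt

mutual
/-- A total left inverse of `encForm`, structural in `Nat.pair`. -/
def decForm (n : ℕ) : CForm :=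
  if _h : n.unpair.1 = 0 then .atom n.unpair.2
  else if n.unpair.1 = 1 then .and (decForm n.unpair.2.unpair.1) (decForm n.unpair.2.unpair.2)
  else if n.unpair.1 = 2 then .not (decForm n.unpair.2)
  else if n.unpair.1 = 3 then
    .eu (decForm n.unpair.2.unpair.1) (decConstr n.unpair.2.unpair.2.unpair.1)
      (decForm n.unpair.2.unpair.2.unpair.2)
  else
    .au (decForm n.unpair.2.unpair.1) (decConstr n.unpair.2.unpair.2.unpair.1)
      (decForm n.unpair.2.unpair.2.unpair.2)
termination_by (n, 0)
decreasing_by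
  · exact Prod.Lex.left _ _ (unpair_snd_fst_lt _h)
  · exact Prod.Lex.left _ _ (unpair_snd_snd_lt _h)
  · exact Prod.Lex.left _ _ (unpair_snd_lt _h)
  · exact Prod.Lex.left _ _ (unpair_snd_fst_lt _h)
  · exact Prod.Lex.left _ _ ((Nat.unpair_left_le _).trans_lt (unpair_snd_snd_lt _h))
  · exact Prod.Lex.left _ _ ((Nat.unpair_right_le _).trans_lt (unpair_snd_snd_lt _h))
  · exact Prod.Lex.left _ _ (unpair_snd_fst_lt _h)
  · exact Prod.Lex.left _ _ ((Nat.unpair_left_le _).trans_lt (unpair_snd_snd_lt _h))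
  · exact Prod.Lex.left _ _ ((Nat.unpair_right_le _).trans_lt (unpair_snd_snd_lt _h))

/-- A total left inverse of `encLin`. -/
def decLin (n : ℕ) : LinExp :=
  if _h : n.unpair.1 = 0 then .term n.unpair.2.unpair.1 (decForm n.unpair.2.unpair.2)
  else .add (decLin n.unpair.2.unpair.1) (decLin n.unpair.2.unpair.2)
termination_by (n, 1)
decreasing_by
  · rcases (unpair_snd_snd_le n).lt_or_eq with h' | h'
    · exact Prod.Lex.left _ _ h'
    · rw [h']; exact Prod.Lex.right _ Nat.zero_lt_one
  · exact Prod.Lex.left _ _ (unpair_snd_fst_lt _h)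
  · exact Prod.Lex.left _ _ (unpair_snd_snd_lt _h)

/-- A total left inverse of `encConstr`. -/
def decConstr (n : ℕ) : Constr :=
  if _h : n.unpair.1 = 0 then
    .atomic (decLin n.unpair.2.unpair.1) (decCmp n.unpair.2.unpair.2.unpair.1)
      n.unpair.2.unpair.2.unpair.2
  else if n.unpair.1 = 1 then
    .cand (decConstr n.unpair.2.unpair.1) (decConstr n.unpair.2.unpair.2)
  else .cnot (decConstr n.unpair.2)
termination_by (n, 2)
decreasing_by
  · rcases (unpair_snd_fst_le n).lt_or_eq with h' | h'
    · exact Prod.Lex.left _ _ h'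
    · rw [h']; exact Prod.Lex.right _ Nat.one_lt_two
  · exact Prod.Lex.left _ _ (unpair_snd_fst_lt _h)
  · exact Prod.Lex.left _ _ (unpair_snd_snd_lt _h)
  · exact Prod.Lex.left _ _ (unpair_snd_lt _h)
end

mutual
theorem decForm_encForm : ∀ φ : CForm, decForm (encForm φ) = φ
  | .atom p => by rw [encForm, decForm]; simp
  | .and φ ψ => by
      rw [encForm, decForm]; simp [decForm_encForm φ, decForm_encForm ψ]
  | .not φ => by rw [encForm, decForm]; simp [decForm_encForm φ]
  | .eu φ C ψ => by
      rw [encForm, decForm]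
      simp [decForm_encForm φ, decConstr_encConstr C, decForm_encForm ψ]
  | .au φ C ψ => by
      rw [encForm, decForm]
      simp [decForm_encForm φ, decConstr_encConstr C, decForm_encForm ψ]

theorem decLin_encLin : ∀ e : LinExp, decLin (encLin e) = e
  | .term a φ => by rw [encLin, decLin]; simp [decForm_encForm φ]
  | .add e f => by rw [encLin, decLin]; simp [decLin_encLin e, decLin_encLin f]

theorem decConstr_encConstr : ∀ C : Constr, decConstr (encConstr C) = C
  | .atomic e c k => by
      cases c <;> rw [encConstr, decConstr] <;> simp [decLin_encLin e, decCmp]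
  | .cand C D => by
      rw [encConstr, decConstr]; simp [decConstr_encConstr C, decConstr_encConstr D]
  | .cnot C => by rw [encConstr, decConstr]; simp [decConstr_encConstr C]
end

/-! ### Derivatives of constraints -/

/-- The contribution of one state with valuation `t` to a coded linear expression. -/
def linWeight (t n : ℕ) : ℕ :=
  if _h : n.unpair.1 = 0 then
    if t.testBit n.unpair.2.unpair.2 then n.unpair.2.unpair.1 else 0
  else linWeight t n.unpair.2.unpair.1 + linWeight t n.unpair.2.unpair.2
termination_by n
decreasing_by
  · exact unpair_snd_fst_lt _h
  · exact unpair_snd_snd_lt _h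

/-- Truth of an atomic constraint, as a function of its coded operator and its bound,
on the empty prefix. -/
def atomicNil (x : ℕ) : Bool :=
  if x.unpair.1 = 0 then decide (0 < x.unpair.2)
  else if x.unpair.1 = 1 then true
  else decide (x.unpair.1 ≤ 3 ∧ x.unpair.2 = 0)

/-- Truth of a coded constraint on the empty prefix. -/
def constrNil (n : ℕ) : Bool :=
  if _h : n.unpair.1 = 0 then atomicNil n.unpair.2.unpair.2
  else if n.unpair.1 = 1 then constrNil n.unpair.2.unpair.1 && constrNil n.unpair.2.unpair.2
  else !constrNil n.unpair.2
termination_by n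
decreasing_by
  · exact unpair_snd_fst_lt _h
  · exact unpair_snd_snd_lt _h
  · exact unpair_snd_lt _h

/-- The operator and bound that remain after a contribution of weight `w`. -/
def atomicDeriv (w x : ℕ) : ℕ :=
  if w ≤ x.unpair.2 then Nat.pair x.unpair.1 (x.unpair.2 - w)
  else if x.unpair.1 < 3 then Nat.pair 0 0 else Nat.pair 3 0

/-- The coded constraint that remains after reading one state with valuation `t`. -/
def constrDeriv (t n : ℕ) : ℕ :=
  if _h : n.unpair.1 = 0 then
    Nat.pair 0 (Nat.pair n.unpair.2.unpair.1
      (atomicDeriv (linWeight t n.unpair.2.unpair.1) n.unpair.2.unpair.2))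
  else if n.unpair.1 = 1 then
    Nat.pair 1 (Nat.pair (constrDeriv t n.unpair.2.unpair.1) (constrDeriv t n.unpair.2.unpair.2))
  else Nat.pair n.unpair.1 (constrDeriv t n.unpair.2)
termination_by n
decreasing_by
  · exact unpair_snd_fst_lt _h
  · exact unpair_snd_snd_lt _h
  · exact unpair_snd_lt _h

theorem atomicDeriv_le (w x : ℕ) : atomicDeriv w x ≤ x := by
  conv_rhs => rw [← Nat.pair_unpair x]
  unfold atomicDeriv
  split_ifs with h1 h2
  · exact pair_le_pair le_rfl (Nat.sub_le _ _)
  · exact pair_le_pair (Nat.zero_le _) (Nat.zero_le _)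
  · exact pair_le_pair (by omega) (Nat.zero_le _)

theorem constrDeriv_le (t n : ℕ) : constrDeriv t n ≤ n := by
  induction n using Nat.strong_induction_on with
  | _ n ih =>
    rw [constrDeriv]
    conv_rhs => rw [← Nat.pair_unpair n]
    split_ifs with h h1
    · rw [h]
      refine pair_le_pair le_rfl ?_
      conv_rhs => rw [← Nat.pair_unpair n.unpair.2]
      exact pair_le_pair le_rfl (atomicDeriv_le _ _)
    · rw [h1]
      refine pair_le_pair le_rfl ?_
      conv_rhs => rw [← Nat.pair_unpair n.unpair.2]
      exact pair_le_pair (ih _ (unpair_snd_fst_lt h)) (ih _ (unpair_snd_snd_lt h))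
    · exact pair_le_pair le_rfl (ih _ (unpair_snd_lt h))

section Semantics

variable {Q : Type} (S : Kripke Q)

/-- The valuation number `t` is correct at `q` for all formula codes up to `N`. -/
def Agrees (t N : ℕ) (q : Q) : Prop :=
  ∀ m ≤ N, t.testBit m = true ↔ sat S (decForm m) q

variable {S}

theorem Agrees.mono {t M N : ℕ} {q : Q} (h : Agrees S t N q) (hMN : M ≤ N) : Agrees S t M q :=
  fun m hm => h m (hm.trans hMN)

theorem lval_cons {t : ℕ} {q : Q} (σ : List Q) (n : ℕ) (h : Agrees S t n q) :
    lval S (decLin n) (q :: σ) = linWeight t n + lval S (decLin n) σ := by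
  induction n using Nat.strong_induction_on with
  | _ n ih =>
    rw [decLin, linWeight]
    split_ifs with h0 h1
    · have := (h _ (unpair_snd_snd_le n)).1 h1
      simp only [lval, countSat, this, if_true]
      ring
    · have : ¬ sat S (decForm n.unpair.2.unpair.2) q := fun h' =>
        h1 ((h _ (unpair_snd_snd_le n)).2 h')
      simp only [lval, countSat, this, if_false]
      ring
    · have h1 := unpair_snd_fst_lt h0
      have h2 := unpair_snd_snd_lt h0
      simp only [lval, ih _ h1 (h.mono h1.le), ih _ h2 (h.mono h2.le)]
      ring

theorem lval_nil (n : ℕ) : lval S (decLin n) [] = 0 := by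
  induction n using Nat.strong_induction_on with
  | _ n ih =>
    rw [decLin]
    split_ifs with h0
    · simp [lval, countSat]
    · simp [lval, ih _ (unpair_snd_fst_lt h0), ih _ (unpair_snd_snd_lt h0)]

theorem eval_decCmp_zero (x : ℕ) :
    (decCmp x.unpair.1).eval 0 x.unpair.2 ↔ atomicNil x = true := by
  unfold atomicNil
  generalize x.unpair.1 = c
  match c with
  | 0 => simp [decCmp, Cmp.eval]
  | 1 => simp [decCmp, Cmp.eval]
  | 2 => simp [decCmp, Cmp.eval, eq_comm]
  | 3 => simp [decCmp, Cmp.eval]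
  | n + 4 => simp [decCmp, Cmp.eval]

theorem eval_decCmp_add (w s x : ℕ) :
    (decCmp x.unpair.1).eval (w + s) x.unpair.2 ↔
      (decCmp (atomicDeriv w x).unpair.1).eval s (atomicDeriv w x).unpair.2 := by
  unfold atomicDeriv
  generalize x.unpair.1 = c
  generalize x.unpair.2 = k
  split_ifs with h1 h2
  · simp only [Nat.unpair_pair]
    match c with
    | 0 => simp only [decCmp, Cmp.eval]; omega
    | 1 => simp only [decCmp, Cmp.eval]; omega
    | 2 => simp only [decCmp, Cmp.eval]; omega
    | 3 => simp only [decCmp, Cmp.eval]; omega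
    | n + 4 => simp only [decCmp, Cmp.eval]; omega
  · simp only [Nat.unpair_pair]
    match c with
    | 0 => simp only [decCmp, Cmp.eval]; omega
    | 1 => simp only [decCmp, Cmp.eval]; omega
    | 2 => simp only [decCmp, Cmp.eval]; omega
    | n + 3 => omega
  · simp only [Nat.unpair_pair]
    match c with
    | 0 => omega
    | 1 => omega
    | 2 => omega
    | 3 => simp only [decCmp, Cmp.eval]; omega
    | n + 4 => simp only [decCmp, Cmp.eval]; omega

theorem csat_nil (n : ℕ) : csat S (decConstr n) [] ↔ constrNil n = true := by
  induction n using Nat.strong_induction_on with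
  | _ n ih =>
    rw [decConstr, constrNil]
    split_ifs with h0 h1
    · simp only [csat, lval_nil, eval_decCmp_zero]
    · simp only [csat, ih _ (unpair_snd_fst_lt h0), ih _ (unpair_snd_snd_lt h0), Bool.and_eq_true]
    · simp [csat, ih _ (unpair_snd_lt h0)]

theorem csat_cons {t : ℕ} {q : Q} (σ : List Q) (n : ℕ) (h : Agrees S t n q) :
    csat S (decConstr n) (q :: σ) ↔ csat S (decConstr (constrDeriv t n)) σ := by
  induction n using Nat.strong_induction_on with
  | _ n ih =>
    rw [decConstr, constrDeriv]
    split_ifs with h0 h1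
    · conv_rhs => rw [decConstr]
      simp only [csat, lval_cons σ _ (h.mono (unpair_snd_fst_le n)), eval_decCmp_add,
        Nat.unpair_pair, dite_true]
    · have h2 := unpair_snd_fst_lt h0
      have h3 := unpair_snd_snd_lt h0
      conv_rhs => rw [decConstr]
      simp [csat, ih _ h2 (h.mono h2.le), ih _ h3 (h.mono h3.le)]
    · have h2 := unpair_snd_lt h0
      conv_rhs => rw [decConstr]
      simp [csat, ih _ h2 (h.mono h2.le), h0, h1]

end Semantics

/-! ### Eventualities -/

/-- The coded eventuality `n` is fulfilled at once at a state with valuation `t`. -/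
def evFul (n t : ℕ) : Bool :=
  t.testBit n.unpair.2.unpair.2.unpair.2 && constrNil n.unpair.2.unpair.2.unpair.1

/-- The invariant part of the coded eventuality `n` holds at a state with valuation `t`. -/
def evHold (n t : ℕ) : Bool :=
  t.testBit n.unpair.2.unpair.1

/-- The coded eventuality that remains of `n` after a state with valuation `t`. -/
def evNext (n t : ℕ) : ℕ :=
  Nat.pair n.unpair.1 (Nat.pair n.unpair.2.unpair.1
    (Nat.pair (constrDeriv t n.unpair.2.unpair.2.unpair.1) n.unpair.2.unpair.2.unpair.2))

theorem evNext_le (n t : ℕ) : evNext n t ≤ n := by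
  conv_rhs => rw [← Nat.pair_unpair n, ← Nat.pair_unpair n.unpair.2,
    ← Nat.pair_unpair n.unpair.2.unpair.2]
  exact pair_le_pair le_rfl (pair_le_pair le_rfl (pair_le_pair (constrDeriv_le _ _) le_rfl))

@[simp]
theorem evNext_fst (n t : ℕ) : (evNext n t).unpair.1 = n.unpair.1 := by simp [evNext]

/-- The arguments of the coded eventuality `n` are coded by numbers up to `N`. -/
def EvBound (N n : ℕ) : Prop :=
  n.unpair.2.unpair.1 ≤ N ∧ n.unpair.2.unpair.2.unpair.1 ≤ N ∧ n.unpair.2.unpair.2.unpair.2 ≤ N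

theorem EvBound.evNext {N n : ℕ} (h : EvBound N n) (t : ℕ) : EvBound N (evNext n t) := by
  simpa [EvBound, _root_.evNext] using ⟨h.1, (constrDeriv_le _ _).trans h.2.1, h.2.2⟩

theorem evBound_of_lt {M n : ℕ} (h : n ≤ M + 1) (h3 : 3 ≤ n.unpair.1) : EvBound M n := by
  have h0 : n.unpair.1 ≠ 0 := by omega
  have h1 := unpair_snd_fst_lt h0
  have h2 := unpair_snd_snd_lt h0
  have h4 := Nat.unpair_left_le n.unpair.2.unpair.2
  have h5 := Nat.unpair_right_le n.unpair.2.unpair.2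
  exact ⟨by omega, by omega, by omega⟩

section Approx

variable {Q : Type} (R : Q → Q → Prop) (V : Q → ℕ)

/-- One unfolding of the coded eventuality `n` at `q`, where `P` tells at which states
the remaining eventuality holds; the path quantifier is existential iff the tag is `3`. -/
def evStep (P : Q → Prop) (n : ℕ) (q : Q) : Prop :=
  evFul n (V q) = true ∨ evHold n (V q) = true ∧
    if n.unpair.1 = 3 then ∃ r, R q r ∧ P r else ∀ r, R q r → P r

/-- The coded eventuality `n` is fulfilled at `q` in fewer than `k` steps. -/
def approx : ℕ → ℕ → Q → Prop
  | 0, _, _ => False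
  | k + 1, n, q => evStep R V (approx k (evNext n (V q))) n q

variable {R V}

theorem evStep_mono {P P' : Q → Prop} {n : ℕ} {q : Q} (h : ∀ q', R q q' → P q' → P' q')
    (hP : evStep R V P n q) : evStep R V P' n q := by
  unfold evStep at *
  rcases hP with hP | ⟨h1, h2⟩
  · exact .inl hP
  · refine .inr ⟨h1, ?_⟩
    split_ifs at h2 ⊢ with h3
    · obtain ⟨q', hq, hP⟩ := h2
      exact ⟨q', hq, h q' hq hP⟩
    · exact fun q' hq => h q' hq (h2 q' hq)

theorem approx_succ {k n : ℕ} {q : Q} (h : approx R V k n q) : approx R V (k + 1) n q := by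
  induction k generalizing n q with
  | zero => exact h.elim
  | succ k ih => exact evStep_mono (fun q' _ h' => ih h') h

theorem approx_mono {k l n : ℕ} {q : Q} (hkl : k ≤ l) (h : approx R V k n q) :
    approx R V l n q := by
  induction hkl with
  | refl => exact h
  | step _ ih => exact approx_succ ih

theorem exists_approx_iff [Finite Q] (n : ℕ) (q : Q) :
    (∃ k, approx R V k n q) ↔
      evStep R V (fun q' => ∃ k, approx R V k (evNext n (V q)) q') n q := by
  constructor
  · rintro ⟨_ | k, h⟩
    · exact h.elim
    · exact evStep_mono (fun q' _ h' => ⟨k, h'⟩) h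
  · intro h
    have := Fintype.ofFinite Q
    have hf : ∀ q', ∃ k, (∃ k, approx R V k (evNext n (V q)) q') →
        approx R V k (evNext n (V q)) q' := fun q' => by
      by_cases h : ∃ k, approx R V k (evNext n (V q)) q'
      · exact ⟨h.choose, fun _ => h.choose_spec⟩
      · exact ⟨0, fun h' => (h h').elim⟩
    choose f hf using hf
    exact ⟨Finset.univ.sup f + 1, evStep_mono
      (fun q' _ h' => approx_mono (Finset.le_sup (Finset.mem_univ q')) (hf q' h')) h⟩

end Approx

section Paths

variable {Q : Type} (S : Kripke Q)

/-- The coded eventuality `n` is fulfilled at position `i` of `ρ`. -/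
def FulAt (n : ℕ) (ρ : ℕ → Q) (i : ℕ) : Prop :=
  sat S (decForm n.unpair.2.unpair.2.unpair.2) (ρ i) ∧
    csat S (decConstr n.unpair.2.unpair.2.unpair.1) (runPrefix ρ i) ∧
      ∀ j < i, sat S (decForm n.unpair.2.unpair.1) (ρ j)

variable {S}

theorem sat_decForm_eu {n : ℕ} (h : n.unpair.1 = 3) (q : Q) :
    sat S (decForm n) q ↔ ∃ ρ, S.Run ρ ∧ ρ 0 = q ∧ ∃ i, FulAt S n ρ i := by
  rw [decForm]
  simp [h, sat, FulAt]

theorem sat_decForm_au {n : ℕ} (h : 3 < n.unpair.1) (q : Q) :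
    sat S (decForm n) q ↔ ∀ ρ, S.Run ρ → ρ 0 = q → ∃ i, FulAt S n ρ i := by
  have h0 : n.unpair.1 ≠ 0 := by omega
  have h1 : n.unpair.1 ≠ 1 := by omega
  have h2 : n.unpair.1 ≠ 2 := by omega
  have h3 : n.unpair.1 ≠ 3 := by omega
  rw [decForm]
  simp [h0, h1, h2, h3, sat, FulAt]

theorem runPrefix_succ (ρ : ℕ → Q) (i : ℕ) :
    runPrefix ρ (i + 1) = ρ 0 :: runPrefix (fun j => ρ (j + 1)) i := by
  simp [runPrefix, List.range_succ_eq_map, Function.comp_def]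

variable {N n : ℕ} {V : Q → ℕ}

theorem fulAt_zero (hV : ∀ q, Agrees S (V q) N q) (hn : EvBound N n) (ρ : ℕ → Q) :
    FulAt S n ρ 0 ↔ evFul n (V (ρ 0)) = true := by
  simp [FulAt, evFul, runPrefix, csat_nil, hV (ρ 0) _ hn.2.2]

theorem fulAt_succ (hV : ∀ q, Agrees S (V q) N q) (hn : EvBound N n) (ρ : ℕ → Q) (i : ℕ) :
    FulAt S n ρ (i + 1) ↔ evHold n (V (ρ 0)) = true ∧
      FulAt S (evNext n (V (ρ 0))) (fun j => ρ (j + 1)) i := by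
  simp only [FulAt, evHold, runPrefix_succ, csat_cons _ _ ((hV (ρ 0)).mono hn.2.1), evNext,
    Nat.unpair_pair, hV (ρ 0) _ hn.1, Nat.forall_lt_succ_left']
  tauto

theorem exists_run (S : Kripke Q) (q : Q) : ∃ ρ, S.Run ρ ∧ ρ 0 = q := by
  choose f hf using S.total
  exact ⟨fun i => f^[i] q, fun i => by simpa [Function.iterate_succ_apply'] using hf _, rfl⟩

theorem Kripke.Run.cons {ρ : ℕ → Q} (hρ : S.Run ρ) {q : Q} (h : S.R q (ρ 0)) :
    S.Run (fun i => Nat.casesOn i q ρ) := by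
  rintro (_ | i)
  · exact h
  · exact hρ i

theorem Kripke.Run.tail {ρ : ℕ → Q} (hρ : S.Run ρ) : S.Run (fun i => ρ (i + 1)) :=
  fun i => hρ (i + 1)

theorem sat_eu_iff_approx [Finite Q] (hV : ∀ q, Agrees S (V q) N q) (hn : EvBound N n)
    (h3 : n.unpair.1 = 3) (q : Q) :
    sat S (decForm n) q ↔ ∃ k, approx S.R V k n q := by
  rw [sat_decForm_eu h3]
  constructor
  · rintro ⟨ρ, hρ, rfl, i, hi⟩
    refine ⟨i + 1, ?_⟩
    induction i generalizing n ρ with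
    | zero => exact .inl ((fulAt_zero hV hn ρ).1 hi)
    | succ i ih =>
      obtain ⟨h1, h2⟩ := (fulAt_succ hV hn ρ i).1 hi
      refine .inr ⟨h1, ?_⟩
      rw [if_pos h3]
      have h4 : (evNext n (V (ρ 0))).unpair.1 = 3 := by rwa [evNext_fst]
      exact ⟨ρ 1, hρ 0, ih (hn.evNext (V (ρ 0))) h4 (fun j => ρ (j + 1)) hρ.tail h2⟩
  · rintro ⟨k, h⟩
    induction k generalizing n q with
    | zero => exact h.elim
    | succ k ih =>
      rcases h with h | ⟨h1, h2⟩
      · obtain ⟨ρ, hρ, rfl⟩ := exists_run S q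
        exact ⟨ρ, hρ, rfl, 0, (fulAt_zero hV hn ρ).2 h⟩
      · rw [if_pos h3] at h2
        obtain ⟨q', hq, h2⟩ := h2
        have h4 : (evNext n (V q)).unpair.1 = 3 := by rwa [evNext_fst]
        obtain ⟨ρ, hρ, rfl, i, hi⟩ := ih (hn.evNext (V q)) h4 q' h2
        exact ⟨_, hρ.cons hq, rfl, i + 1, (fulAt_succ hV hn _ i).2 ⟨h1, hi⟩⟩

theorem sat_au_iff_approx [Finite Q] (hV : ∀ q, Agrees S (V q) N q) (hn : EvBound N n)
    (h3 : 3 < n.unpair.1) (q : Q) :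
    sat S (decForm n) q ↔ ∃ k, approx S.R V k n q := by
  rw [sat_decForm_au h3]
  constructor
  · intro h
    by_contra hq
    have hstep : ∀ x : ℕ × Q, ∃ q', S.R x.2 q' ∧ ((∃ k, approx S.R V k x.1 x.2) ∨
        evHold x.1 (V x.2) = false ∨ ¬ ∃ k, approx S.R V k (evNext x.1 (V x.2)) q') := by
      rintro ⟨m, q⟩
      by_contra! hcon
      obtain ⟨q', hq'⟩ := S.total q
      refine not_exists.2 (hcon q' hq').1 ((exists_approx_iff m q).2 ?_)
      refine .inr ⟨by simpa using (hcon q' hq').2.1, ?_⟩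
      split_ifs
      · exact ⟨q', hq', (hcon q' hq').2.2⟩
      · exact fun q' hq' => (hcon q' hq').2.2
    choose f hf using hstep
    let g : ℕ × Q → ℕ × Q := fun x => (evNext x.1 (V x.2), f x)
    have hrun : S.Run (fun i => (g^[i] (n, q)).2) := fun i => by
      simpa only [Function.iterate_succ_apply'] using (hf _).1
    obtain ⟨i, hi⟩ := h _ hrun rfl
    clear hrun h
    induction i generalizing n q with
    | zero =>
      have h1 := (fulAt_zero hV hn (fun i => (g^[i] (n, q)).2)).1 hi
      simp only [Function.iterate_zero, id] at h1
      exact hq ((exists_approx_iff n q).2 (Or.inl h1))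
    | succ i ih =>
      have hi' : FulAt S n (fun i => (g^[i] (n, q)).2) (i + 1) := hi
      obtain ⟨h1, h2⟩ := (fulAt_succ hV hn (fun i => (g^[i] (n, q)).2) i).1 hi'
      simp only [Function.iterate_zero, id, Function.iterate_succ_apply] at h1 h2
      rcases (hf (n, q)).2 with h | h | h
      · exact hq h
      · exact Bool.false_ne_true (h.symm.trans h1)
      · exact ih (hn.evNext (V q)) (by rwa [evNext_fst]) (f (n, q)) h h2
  · rintro ⟨k, h⟩ ρ hρ rfl
    induction k generalizing n ρ with
    | zero => exact h.elim
    | succ k ih =>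
      rcases h with h | ⟨h1, h2⟩
      · exact ⟨0, (fulAt_zero hV hn ρ).2 h⟩
      · rw [if_neg h3.ne'] at h2
        have h4 : 3 < (evNext n (V (ρ 0))).unpair.1 := by rwa [evNext_fst]
        obtain ⟨i, hi⟩ := ih (hn.evNext (V (ρ 0))) h4 (fun j => ρ (j + 1)) hρ.tail (h2 (ρ 1) (hρ 0))
        exact ⟨i + 1, (fulAt_succ hV hn ρ i).2 ⟨h1, hi⟩⟩

theorem sat_iff_approx [Finite Q] (hV : ∀ q, Agrees S (V q) N q) (hn : EvBound N n)
    (h3 : 3 ≤ n.unpair.1) (q : Q) :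
    sat S (decForm n) q ↔ ∃ k, approx S.R V k n q := by
  rcases h3.eq_or_lt with h | h
  · exact sat_eu_iff_approx hV hn h.symm q
  · exact sat_au_iff_approx hV hn h q

end Paths

/-! ### Certificates -/

/-- The number whose set bits are the numbers below `N` satisfying `P`. -/
def numOf (N : ℕ) (P : ℕ → Prop) : ℕ :=
  Nat.ofBits fun i : Fin N => decide (P i)

theorem numOf_lt (N : ℕ) (P : ℕ → Prop) : numOf N P < 2 ^ N :=
  Nat.ofBits_lt_two_pow _

theorem testBit_numOf {N : ℕ} {P : ℕ → Prop} {i : ℕ} :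
    (numOf N P).testBit i = true ↔ i < N ∧ P i := by
  unfold numOf
  by_cases h : i < N
  · simp [Nat.testBit_ofBits_lt _ _ h, h]
  · simp [Nat.testBit_ofBits_ge _ _ (not_lt.1 h), h]

/-- States of a certificate are pairs of a valuation and a focus, both sets of numbers
below `N`; all of them are below this bound. -/
def stateBound (N : ℕ) : ℕ :=
  Nat.pair (2 ^ N) (2 ^ N)

theorem lt_stateBound {N t o : ℕ} (ht : t < 2 ^ N) (ho : o < 2 ^ N) :
    Nat.pair t o < stateBound N :=
  (Nat.pair_lt_pair_left _ ht).trans (Nat.pair_lt_pair_right _ ho)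

/-- The binary relation coded by the number `E`. -/
def edge (E s s' : ℕ) : Prop :=
  E.testBit (Nat.pair s s') = true

/-- The transition relation of a certificate. -/
def certRel (N E s t : ℕ) : Prop :=
  t < stateBound N ∧ edge E s t

/-- The valuation of a certificate state. -/
def stateVal (s : ℕ) : ℕ := s.unpair.1

/-- The focus of a certificate state: the eventualities being fulfilled. -/
def stateFoc (s : ℕ) : ℕ := s.unpair.2

/-- `s` is a state of the certificate that is in use. -/
def Active (N E s : ℕ) : Prop :=
  ∃ t < stateBound N, edge E s t

/-- Consistency of the valuation of `s` on the code `n`, and progress of the focus of `s`. -/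
def LocalOK (N E L s n : ℕ) : Prop :=
  (n.unpair.1 = 1 → ((stateVal s).testBit n = true ↔
    (stateVal s).testBit n.unpair.2.unpair.1 = true ∧
      (stateVal s).testBit n.unpair.2.unpair.2 = true)) ∧
  (n.unpair.1 = 2 → ((stateVal s).testBit n = true ↔
    ¬ (stateVal s).testBit n.unpair.2 = true)) ∧
  (3 ≤ n.unpair.1 → ((stateVal s).testBit n = true ↔
    evStep (certRel N E) stateVal
      (fun s' => (stateVal s').testBit (evNext n (stateVal s)) = true) n s)) ∧
  (3 ≤ n.unpair.1 → (stateFoc s).testBit n = true → (stateVal s).testBit n = true →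
    evStep (certRel N E) stateVal
      (fun s' => (stateVal s').testBit (evNext n (stateVal s)) = true ∧
        (stateFoc s').testBit (evNext n (stateVal s)) = true ∧ edge L s' s) n s)

/-- The focus of `s` contains every eventuality in its valuation. -/
def FullFocus (N s : ℕ) : Prop :=
  ∀ n < N, 3 ≤ n.unpair.1 → (stateVal s).testBit n = true → (stateFoc s).testBit n = true

/-- `E` codes the transitions and `L` a strict order witnessing progress. -/
def IsCert (N E L : ℕ) : Prop :=
  (∀ s < stateBound N, ∀ s' < stateBound N, edge E s s' → Active N E s') ∧
  (∀ s < stateBound N, ¬ edge L s s) ∧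
  (∀ s < stateBound N, ∀ s' < stateBound N, ∀ s'' < stateBound N,
    edge L s s' → edge L s' s'' → edge L s s'') ∧
  (∀ s < stateBound N, ∀ s' < stateBound N, edge E s s' → edge L s' s ∨ FullFocus N s') ∧
  (∀ s < stateBound N, Active N E s → ∀ n < N, LocalOK N E L s n)

/-- `c` codes a certificate in which the formula coded by `n` occurs. -/
def Certifies (n c : ℕ) : Prop :=
  IsCert (n + 1) c.unpair.1 c.unpair.2 ∧
    ∃ s < stateBound (n + 1), Active (n + 1) c.unpair.1 s ∧ (stateVal s).testBit n = true

/-- A bound for the certificates that have to be considered for `n`. -/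
def certBound (n : ℕ) : ℕ :=
  Nat.pair (2 ^ Nat.pair (stateBound (n + 1)) (stateBound (n + 1)))
    (2 ^ Nat.pair (stateBound (n + 1)) (stateBound (n + 1)))

theorem evStep_iff_of_image {Q Q' : Type} {R : Q → Q → Prop} {R' : Q' → Q' → Prop}
    {V : Q → ℕ} {V' : Q' → ℕ} {P : Q → Prop} {P' : Q' → Prop} {n : ℕ} {q : Q} {s : Q'}
    (f : Q → Q') (hV : V q = V' s) (h1 : ∀ q', R q q' → R' s (f q'))
    (h2 : ∀ y, R' s y → ∃ q', f q' = y ∧ R q q') (hP : ∀ q', R q q' → (P q' ↔ P' (f q'))) :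
    evStep R V P n q ↔ evStep R' V' P' n s := by
  unfold evStep
  rw [hV]
  refine or_congr_right (and_congr_right fun _ => ?_)
  split_ifs
  · constructor
    · rintro ⟨q', hq, h⟩
      exact ⟨f q', h1 q' hq, (hP q' hq).1 h⟩
    · rintro ⟨y, hy, h⟩
      obtain ⟨q', rfl, hq⟩ := h2 y hy
      exact ⟨q', hq, (hP q' hq).2 h⟩
  · constructor
    · intro h y hy
      obtain ⟨q', rfl, hq⟩ := h2 y hy
      exact (hP q' hq).1 (h q' hq)
    · exact fun h r hr => (hP r hr).2 (h _ (h1 r hr))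

/-! ### Soundness of certificates -/

theorem testBit_iff_approx {Q : Type} [Finite Q] {R : Q → Q → Prop} {V O : Q → ℕ}
    {A : Q → Prop} {L : Q → Q → Prop} (hL : WellFounded L) {N : ℕ}
    (hA : ∀ q q', A q → R q q' → A q')
    (hloc : ∀ q, A q → ∀ n < N, 3 ≤ n.unpair.1 → ((V q).testBit n = true ↔
      evStep R V (fun q' => (V q').testBit (evNext n (V q)) = true) n q))
    (hfoc : ∀ q, A q → ∀ n < N, 3 ≤ n.unpair.1 → (O q).testBit n = true →
      (V q).testBit n = true → evStep R V (fun q' => (V q').testBit (evNext n (V q)) = true ∧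
        (O q').testBit (evNext n (V q)) = true ∧ L q' q) n q)
    (hedge : ∀ q q', A q → R q q' → L q' q ∨
      ∀ n < N, 3 ≤ n.unpair.1 → (V q').testBit n = true → (O q').testBit n = true)
    {n : ℕ} (hn : n < N) (h3 : 3 ≤ n.unpair.1) {q : Q} (hq : A q) :
    (V q).testBit n = true ↔ ∃ k, approx R V k n q := by
  have hnext : ∀ {n t}, n < N → evNext n t < N := fun h => (evNext_le _ _).trans_lt h
  have h3next : ∀ {n t}, 3 ≤ n.unpair.1 → 3 ≤ (evNext n t).unpair.1 := fun h => by
    rwa [evNext_fst]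
  have focused : ∀ q n, n < N → 3 ≤ n.unpair.1 → A q → (O q).testBit n = true →
      (V q).testBit n = true → ∃ k, approx R V k n q := by
    intro q
    induction q using hL.induction with
    | _ q ih =>
      intro n hn h3 hq hO hV
      exact (exists_approx_iff n q).2 (evStep_mono
        (fun q' hqq' ⟨h1, h2, h4⟩ => ih q' h4 _ (hnext hn) (h3next h3) (hA q q' hq hqq') h2 h1)
        (hfoc q hq n hn h3 hO hV))
  constructor
  · induction q using hL.induction generalizing n with
    | _ q ih =>
      intro hV
      refine (exists_approx_iff n q).2 (evStep_mono (fun q' hqq' h => ?_)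
        ((hloc q hq n hn h3).1 hV))
      rcases hedge q q' hq hqq' with h' | h'
      · exact ih q' h' (hnext hn) (h3next h3) (hA q q' hq hqq') h
      · exact focused q' _ (hnext hn) (h3next h3) (hA q q' hq hqq')
          (h' _ (hnext hn) (h3next h3) h) h
  · rintro ⟨k, h⟩
    induction k generalizing n q with
    | zero => exact h.elim
    | succ k ih =>
      exact (hloc q hq n hn h3).2 (evStep_mono
        (fun q' hr hk => ih (hnext hn) (h3next h3) (hA q q' hq hr) hk) h)

/-- The Kripke structure presented by a certificate; unused states get a loop. -/
def certKS (N E : ℕ) : FinKS where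
  n := stateBound N
  edges := ((Finset.range (stateBound N) ×ˢ Finset.range (stateBound N)).filter fun p =>
    edge E p.1 p.2 ∨ p.1 = p.2 ∧ ¬ Active N E p.1).toList
  labels := ((Finset.range (stateBound N) ×ˢ Finset.range N).filter fun p =>
    (stateVal p.1).testBit (Nat.pair 0 p.2) = true).toList

theorem mem_certKS_edges {N E : ℕ} (a b : Fin (certKS N E).n) :
    ((a : ℕ), (b : ℕ)) ∈ (certKS N E).edges ↔
      edge E a b ∨ (a : ℕ) = b ∧ ¬ Active N E a := by
  have ha : (a : ℕ) < stateBound N := a.2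
  have hb : (b : ℕ) < stateBound N := b.2
  simp [certKS, ha, hb]

theorem certKS_total (N E : ℕ) : (certKS N E).Total := by
  intro q
  simp only [mem_certKS_edges]
  by_cases h : Active N E q
  · obtain ⟨s', hs', h⟩ := h
    exact ⟨⟨s', hs'⟩, .inl h⟩
  · exact ⟨q, .inr ⟨rfl, h⟩⟩

theorem certKS_rel {N E : ℕ} {a b : Fin (certKS N E).n} (ha : Active N E a) :
    ((certKS N E).toKripke (certKS_total N E)).R a b ↔ edge E a b := by
  simp [FinKS.toKripke, mem_certKS_edges, ha]

theorem IsCert.agrees {N E L : ℕ} (h : IsCert N E L) {n : ℕ} (hn : n < N)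
    {q : Fin (certKS N E).n} (hq : Active N E q) :
    (stateVal q).testBit n = true ↔
      sat ((certKS N E).toKripke (certKS_total N E)) (decForm n) q := by
  obtain ⟨hact, hirr, htrans, hedge, hlocal⟩ := h
  set K := (certKS N E).toKripke (certKS_total N E) with hK
  let V : Fin (certKS N E).n → ℕ := fun q =>
    if Active N E q then stateVal q else numOf N fun m => sat K (decForm m) q
  have hVact : ∀ q : Fin (certKS N E).n, Active N E q → V q = stateVal q := fun q h => if_pos h
  have hR : ∀ q q' : Fin (certKS N E).n, Active N E q → (K.R q q' ↔ edge E q q') :=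
    fun q q' h => certKS_rel h
  have hA : ∀ q q' : Fin (certKS N E).n, Active N E q → K.R q q' → Active N E q' :=
    fun q q' h hqq' => hact q q.2 q' q'.2 ((hR q q' h).1 hqq')
  have hL : WellFounded fun a b : Fin (certKS N E).n => edge L a b := by
    have : IsTrans (Fin (certKS N E).n) fun a b => edge L a b :=
      ⟨fun a b c => htrans a a.2 b b.2 c c.2⟩
    have : Std.Irrefl fun a b : Fin (certKS N E).n => edge L a b := ⟨fun a => hirr a a.2⟩
    exact Finite.wellFounded_of_trans_of_irrefl _
  have hstep : ∀ (P : Fin (certKS N E).n → Prop) (P' : ℕ → Prop) (n : ℕ)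
      (q : Fin (certKS N E).n), Active N E q → (∀ q', K.R q q' → (P q' ↔ P' q')) →
      (evStep K.R V P n q ↔ evStep (certRel N E) stateVal P' n q) := fun P P' n q hq hP =>
    evStep_iff_of_image (fun q : Fin (certKS N E).n => (q : ℕ)) (hVact q hq)
      (fun q' h => ⟨q'.2, (hR q q' hq).1 h⟩)
      (fun y hy => ⟨⟨y, hy.1⟩, rfl, (hR _ _ hq).2 hy.2⟩) hP
  have key : ∀ n < N, 3 ≤ n.unpair.1 → ∀ q : Fin (certKS N E).n, Active N E q →
      ((V q).testBit n = true ↔ ∃ k, approx K.R V k n q) := by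
    intro n hn h3 q hq
    refine testBit_iff_approx (A := fun q : Fin (certKS N E).n => Active N E q)
      (O := fun q : Fin (certKS N E).n => stateFoc q) hL hA ?_ ?_ ?_ hn h3 hq
    · intro q hq n hn h3
      rw [hVact q hq, (hlocal q q.2 hq n hn).2.2.1 h3]
      exact (hstep _ _ n q hq fun q' hqq' => by rw [hVact q' (hA q q' hq hqq')]).symm
    · intro q hq n hn h3 hO hV
      rw [hVact q hq] at hV ⊢
      exact (hstep _ _ n q hq fun q' hqq' => by rw [hVact q' (hA q q' hq hqq')]).2
        ((hlocal q q.2 hq n hn).2.2.2 h3 hO hV)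
    · intro q q' hq hqq'
      rw [hVact q' (hA q q' hq hqq')]
      exact hedge q q.2 q' q'.2 ((hR q q' hq).1 hqq')
  have main : ∀ n < N, ∀ q, (V q).testBit n = true ↔ sat K (decForm n) q := by
    intro n
    induction n using Nat.strong_induction_on with
    | _ n ih =>
      intro hn q
      by_cases hq : Active N E q
      swap
      · simp [V, hq, testBit_numOf, hn]
      by_cases h0 : n.unpair.1 = 0
      · rw [decForm, dif_pos h0, sat, hVact q hq]
        have hn' : Nat.pair 0 n.unpair.2 = n := by rw [← h0, Nat.pair_unpair]
        have hn2 : n.unpair.2 < N := (Nat.unpair_right_le n).trans_lt hn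
        simp [hK, FinKS.toKripke, certKS, hn', hn2]
      have l1 := unpair_snd_lt h0
      have l2 := unpair_snd_fst_lt h0
      have l3 := unpair_snd_snd_lt h0
      by_cases h1 : n.unpair.1 = 1
      · rw [decForm, dif_neg h0, if_pos h1, sat, ← ih _ l2 (l2.trans hn), ← ih _ l3 (l3.trans hn),
          hVact q hq]
        exact (hlocal q q.2 hq n hn).1 h1
      by_cases h2 : n.unpair.1 = 2
      · rw [decForm, dif_neg h0, if_neg h1, if_pos h2, sat, ← ih _ l1 (l1.trans hn), hVact q hq]
        exact (hlocal q q.2 hq n hn).2.1 h2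
      have h3 : 3 ≤ n.unpair.1 := by omega
      rw [key n hn h3 q hq]
      refine (sat_iff_approx (N := n - 1) (fun q m hm => ih m (by omega) (by omega) q)
        (evBound_of_lt (by omega) h3) h3 q).symm
  rw [← main n hn q, hVact q hq]

/-! ### Existence of certificates -/

section Completeness

variable {Q : Type} (S : Kripke Q) (N : ℕ)

/-- The valuation of `q` on the formula codes below `N`. -/
def valOf (q : Q) : ℕ :=
  numOf N fun n => sat S (decForm n) q

/-- The number of steps after which the coded eventuality `n` is fulfilled at `q`. -/
def evRank (n : ℕ) (q : Q) : ℕ :=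
  sInf {k | approx S.R (valOf S N) k n q}

/-- The largest rank of an eventuality in the focus `o` at `q`. -/
def focRank (o : ℕ) (q : Q) : ℕ :=
  (Finset.range N).sup fun n => if o.testBit n = true then evRank S N n q else 0

/-- What remains of the focus `o` of `q` on the transition to `q'`. -/
def focRest (o : ℕ) (q q' : Q) : ℕ :=
  numOf N fun n => ∃ m < N, 3 ≤ m.unpair.1 ∧ o.testBit m = true ∧
    n = evNext m (valOf S N q) ∧ (valOf S N q').testBit n = true ∧
    evRank S N n q' < evRank S N m q

/-- The next focus on the transition from `q` to `q'`: the remaining focus while it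
makes progress, and everything otherwise. -/
def focNext (o : ℕ) (q q' : Q) : ℕ :=
  if focRank S N (focRest S N o q q') q' < focRank S N o q then focRest S N o q q'
  else valOf S N q'

theorem exists_repr [Nonempty Q] (t o : ℕ) : ∃ r : Q, (∃ q, valOf S N q = t) →
    valOf S N r = t ∧ ∀ q, valOf S N q = t → focRank S N o r ≤ focRank S N o q := by
  by_cases h : ∃ q, valOf S N q = t
  · obtain ⟨r, hr, hmin⟩ := (InvImage.wf (focRank S N o) Nat.lt_wfRel.wf).has_min
      {q | valOf S N q = t} h
    exact ⟨r, fun _ => ⟨hr, fun q hq => not_lt.1 (hmin q hq)⟩⟩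
  · exact ⟨Classical.arbitrary Q, fun hq => (h hq).elim⟩

/-- A state with valuation `stateVal s` at which the focus of `s` has least rank. -/
def reprOf [Nonempty Q] (s : ℕ) : Q :=
  (exists_repr S N (stateVal s) (stateFoc s)).choose

/-- The certificate state reached along the transition from the representative of `s` to `r`. -/
def succOf [Nonempty Q] (s : ℕ) (r : Q) : ℕ :=
  Nat.pair (valOf S N r) (focNext S N (stateFoc s) (reprOf S N s) r)

/-- The number `s` is a pair of a valuation that occurs in `S` and a focus. -/
def Realized (s : ℕ) : Prop :=
  (∃ q, valOf S N q = stateVal s) ∧ stateFoc s < 2 ^ N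

/-- The transitions of the certificate extracted from `S`. -/
def extractEdges [Nonempty Q] : ℕ :=
  numOf (Nat.pair (stateBound N) (stateBound N)) fun p =>
    Realized S N p.unpair.1 ∧
      ∃ q', S.R (reprOf S N p.unpair.1) q' ∧ succOf S N p.unpair.1 q' = p.unpair.2

/-- The progress measure of the certificate extracted from `S`. -/
def stateRank [Nonempty Q] (s : ℕ) : ℕ :=
  focRank S N (stateFoc s) (reprOf S N s)

/-- The progress order of the certificate extracted from `S`. -/
def extractOrder [Nonempty Q] : ℕ :=
  numOf (Nat.pair (stateBound N) (stateBound N)) fun p =>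
    stateRank S N p.unpair.1 < stateRank S N p.unpair.2

variable {S N}

theorem Realized.lt {s : ℕ} (h : Realized S N s) : s < stateBound N := by
  obtain ⟨⟨q, hq⟩, ho⟩ := h
  rw [← Nat.pair_unpair s]
  exact lt_stateBound (show stateVal s < _ from hq ▸ numOf_lt _ _) ho

theorem focNext_lt (o : ℕ) (q q' : Q) : focNext S N o q q' < 2 ^ N := by
  unfold focNext
  split_ifs
  · exact numOf_lt _ _
  · exact numOf_lt _ _

theorem pair_lt_pair {a b c d : ℕ} (h : a < c) (h' : b < d) : Nat.pair a b < Nat.pair c d :=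
  (Nat.pair_lt_pair_left _ h).trans (Nat.pair_lt_pair_right _ h')

section

variable [Nonempty Q]

theorem Realized.valOf_reprOf {s : ℕ} (h : Realized S N s) :
    valOf S N (reprOf S N s) = stateVal s :=
  ((exists_repr S N (stateVal s) (stateFoc s)).choose_spec h.1).1

theorem stateRank_le {s : ℕ} {q : Q} (h : valOf S N q = stateVal s) :
    stateRank S N s ≤ focRank S N (stateFoc s) q :=
  ((exists_repr S N (stateVal s) (stateFoc s)).choose_spec ⟨q, h⟩).2 q h

@[simp]
theorem stateVal_succOf (s : ℕ) (q' : Q) : stateVal (succOf S N s q') = valOf S N q' := by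
  simp [stateVal, succOf]

@[simp]
theorem stateFoc_succOf (s : ℕ) (q' : Q) :
    stateFoc (succOf S N s q') = focNext S N (stateFoc s) (reprOf S N s) q' := by
  simp [stateFoc, succOf]

theorem realized_succOf (s : ℕ) (q' : Q) : Realized S N (succOf S N s q') :=
  ⟨⟨q', by simp⟩, by simpa using focNext_lt _ _ _⟩

theorem edge_extractEdges {s s' : ℕ} : edge (extractEdges S N) s s' ↔
    Realized S N s ∧ ∃ q', S.R (reprOf S N s) q' ∧ succOf S N s q' = s' := by
  simp only [edge, extractEdges, testBit_numOf, Nat.unpair_pair, and_iff_right_iff_imp]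
  rintro ⟨h, q', -, rfl⟩
  exact pair_lt_pair h.lt (realized_succOf s q').lt

theorem edge_extractOrder {s s' : ℕ} (hs : s < stateBound N) (hs' : s' < stateBound N) :
    edge (extractOrder S N) s s' ↔ stateRank S N s < stateRank S N s' := by
  simp only [edge, extractOrder, testBit_numOf, Nat.unpair_pair, pair_lt_pair hs hs', true_and]

theorem active_extractEdges {s : ℕ} : Active N (extractEdges S N) s ↔ Realized S N s := by
  simp only [Active, edge_extractEdges]
  constructor
  · exact fun ⟨_, _, h, _⟩ => h
  · intro h
    obtain ⟨q', hq'⟩ := S.total (reprOf S N s)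
    exact ⟨_, (realized_succOf s q').lt, h, q', hq', rfl⟩

theorem stateRank_succOf_lt {s : ℕ} {q' : Q}
    (h : focRank S N (focRest S N (stateFoc s) (reprOf S N s) q') q' < stateRank S N s) :
    stateRank S N (succOf S N s q') < stateRank S N s := by
  refine (stateRank_le (q := q') (stateVal_succOf s q').symm).trans_lt ?_
  rw [stateFoc_succOf, focNext,
    if_pos (show _ < focRank S N (stateFoc s) (reprOf S N s) from h)]
  exact h

end

theorem agrees_valOf {M : ℕ} (q : Q) : Agrees S (valOf S (M + 1) q) M q := fun m hm => by
  simp [valOf, testBit_numOf, Nat.lt_succ_of_le hm]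

variable [Finite Q] {M n : ℕ}

theorem testBit_valOf_iff_approx (hn : n < M + 1) (h3 : 3 ≤ n.unpair.1) (q : Q) :
    (valOf S (M + 1) q).testBit n = true ↔ ∃ k, approx S.R (valOf S (M + 1)) k n q := by
  rw [agrees_valOf q n (Nat.le_of_lt_succ hn)]
  exact sat_iff_approx agrees_valOf (evBound_of_lt hn.le h3) h3 q

theorem testBit_valOf_iff_evStep (hn : n < M + 1) (h3 : 3 ≤ n.unpair.1) (q : Q) :
    (valOf S (M + 1) q).testBit n = true ↔ evStep S.R (valOf S (M + 1))
      (fun q' => (valOf S (M + 1) q').testBit (evNext n (valOf S (M + 1) q)) = true) n q := by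
  rw [testBit_valOf_iff_approx hn h3, exists_approx_iff]
  simp only [testBit_valOf_iff_approx ((evNext_le n (valOf S (M + 1) q)).trans_lt hn)
    (by rwa [evNext_fst])]

theorem evRank_spec (hn : n < M + 1) (h3 : 3 ≤ n.unpair.1) {q : Q}
    (h : (valOf S (M + 1) q).testBit n = true) :
    0 < evRank S (M + 1) n q ∧ evStep S.R (valOf S (M + 1)) (fun q' =>
      (valOf S (M + 1) q').testBit (evNext n (valOf S (M + 1) q)) = true ∧
      evRank S (M + 1) (evNext n (valOf S (M + 1) q)) q' < evRank S (M + 1) n q) n q := by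
  have hmem : approx S.R (valOf S (M + 1)) (evRank S (M + 1) n q) n q :=
    Nat.sInf_mem ((testBit_valOf_iff_approx hn h3 q).1 h)
  generalize evRank S (M + 1) n q = k at hmem
  cases k with
  | zero => exact hmem.elim
  | succ k =>
    refine ⟨k.succ_pos, evStep_mono (fun q' _ hq' => ⟨?_, ?_⟩) hmem⟩
    · exact (testBit_valOf_iff_approx ((evNext_le _ _).trans_lt hn) (by rwa [evNext_fst]) q').2
        ⟨k, hq'⟩
    · exact Nat.lt_succ_of_le (Nat.sInf_le hq')

theorem focRank_focRest_lt {o : ℕ} {q : Q} (q' : Q) (hn : n < M + 1) (h3 : 3 ≤ n.unpair.1)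
    (h : (valOf S (M + 1) q).testBit n = true) (ho : o.testBit n = true) :
    focRank S (M + 1) (focRest S (M + 1) o q q') q' < focRank S (M + 1) o q := by
  have hle : ∀ m < M + 1, o.testBit m = true →
      evRank S (M + 1) m q ≤ focRank S (M + 1) o q := fun m hm hom => by
    have := Finset.le_sup (f := fun n => if o.testBit n = true then evRank S (M + 1) n q else 0)
      (Finset.mem_range.2 hm)
    simp only [hom, if_true] at this
    exact this
  have hpos := (evRank_spec hn h3 h).1.trans_le (hle n hn ho)
  refine (Finset.sup_lt_iff hpos).2 fun m _ => ?_
  split_ifs with hm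
  · obtain ⟨_, l, hl, _, hol, _, _, hlt⟩ := testBit_numOf.1 hm
    exact hlt.trans_le (hle l hl hol)
  · exact hpos

variable (S) in
theorem isCert_extract [Nonempty Q] (M : ℕ) :
    IsCert (M + 1) (extractEdges S (M + 1)) (extractOrder S (M + 1)) := by
  refine ⟨fun s _ s' _ h => ?_, fun s hs => ?_, fun s hs s' hs' s'' hs'' => ?_,
    fun s hs s' hs' h => ?_, fun s hs hact n hn => ?_⟩
  · obtain ⟨_, q', _, rfl⟩ := edge_extractEdges.1 h
    exact active_extractEdges.2 (realized_succOf s q')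
  · rw [edge_extractOrder hs hs]
    exact lt_irrefl _
  · rw [edge_extractOrder hs hs', edge_extractOrder hs' hs'', edge_extractOrder hs hs'']
    exact lt_trans
  · obtain ⟨_, q', _, rfl⟩ := edge_extractEdges.1 h
    rw [edge_extractOrder hs' hs]
    by_cases hlt : focRank S (M + 1) (focRest S (M + 1) (stateFoc s) (reprOf S (M + 1) s) q') q'
        < stateRank S (M + 1) s
    · exact .inl (stateRank_succOf_lt hlt)
    · refine .inr fun n _ _ hn => ?_
      rw [stateFoc_succOf, focNext,
        if_neg (show ¬_ < focRank S (M + 1) (stateFoc s) (reprOf S (M + 1) s) from hlt)]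
      rwa [stateVal_succOf] at hn
  · have hreal := active_extractEdges.1 hact
    set r := reprOf S (M + 1) s with hr
    have hval : valOf S (M + 1) r = stateVal s := hreal.valOf_reprOf
    have hbit : ∀ m, m < M + 1 →
        ((stateVal s).testBit m = true ↔ sat S (decForm m) r) := fun m hm => by
      rw [← hval]
      exact agrees_valOf r m (Nat.le_of_lt_succ hm)
    have hstep : ∀ (P : Q → Prop) (P' : ℕ → Prop), (∀ q', S.R r q' →
        (P q' ↔ P' (succOf S (M + 1) s q'))) → (evStep S.R (valOf S (M + 1)) P n r ↔
          evStep (certRel (M + 1) (extractEdges S (M + 1))) stateVal P' n s) := fun P P' hP =>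
      evStep_iff_of_image (succOf S (M + 1) s) hval
        (fun q' h => ⟨(realized_succOf s q').lt, edge_extractEdges.2 ⟨hreal, q', h, rfl⟩⟩)
        (fun y hy => by
          obtain ⟨_, q', h, rfl⟩ := edge_extractEdges.1 hy.2
          exact ⟨q', rfl, h⟩) hP
    refine ⟨fun h1 => ?_, fun h2 => ?_, fun h3 => ?_, fun h3 ho hv => ?_⟩
    · have h0 : n.unpair.1 ≠ 0 := by omega
      rw [hbit n hn, hbit _ ((unpair_snd_fst_lt h0).trans hn),
        hbit _ ((unpair_snd_snd_lt h0).trans hn), decForm, dif_neg h0, if_pos h1, sat]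
    · have h0 : n.unpair.1 ≠ 0 := by omega
      have h1 : n.unpair.1 ≠ 1 := by omega
      rw [hbit n hn, hbit _ ((unpair_snd_lt h0).trans hn), decForm, dif_neg h0, if_neg h1,
        if_pos h2, sat]
    · conv_lhs => rw [← hval]
      rw [testBit_valOf_iff_evStep hn h3, hval]
      exact hstep _ _ fun q' _ => by rw [stateVal_succOf]
    · rw [← hval] at hv
      have hspec := (evRank_spec hn h3 hv).2
      rw [hval] at hspec
      rw [← hstep (fun q' => (valOf S (M + 1) q').testBit (evNext n (stateVal s)) = true ∧
        (stateFoc (succOf S (M + 1) s q')).testBit (evNext n (stateVal s)) = true ∧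
        edge (extractOrder S (M + 1)) (succOf S (M + 1) s q') s)
        _ fun q' _ => by rw [stateVal_succOf]]
      refine evStep_mono (fun q' _ hq' => ?_) hspec
      have hlt := focRank_focRest_lt q' hn h3 hv ho
      refine ⟨hq'.1, ?_, ?_⟩
      · rw [stateFoc_succOf, focNext, if_pos hlt]
        exact testBit_numOf.2 ⟨(evNext_le _ _).trans_lt hn, n, hn, h3, ho, by rw [hval], hq'⟩
      · rw [edge_extractOrder (realized_succOf s q').lt hs]
        exact stateRank_succOf_lt hlt

theorem exists_certifies {q : Q} (h : sat S (decForm n) q) :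
    ∃ c < certBound n, Certifies n c := by
  have : Nonempty Q := ⟨q⟩
  refine ⟨Nat.pair (extractEdges S (n + 1)) (extractOrder S (n + 1)),
    pair_lt_pair (numOf_lt _ _) (numOf_lt _ _), ?_, ?_⟩
  · simpa using isCert_extract S n
  · have hreal : Realized S (n + 1) (Nat.pair (valOf S (n + 1) q) 0) :=
      ⟨⟨q, by simp [stateVal]⟩, by simp [stateFoc]⟩
    refine ⟨_, hreal.lt, ?_, ?_⟩
    · simpa using active_extractEdges.2 hreal
    · simpa [stateVal] using (agrees_valOf q n le_rfl).2 h

end Completeness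

/-- Satisfiability of a coded formula is equivalent to a bounded search. -/
theorem satisfiable_iff (n : ℕ) :
    (∃ c < certBound n, Certifies n c) ↔
      ∃ (M : FinKS) (hM : M.Total) (q : Fin M.n), sat (M.toKripke hM) (decForm n) q := by
  constructor
  · rintro ⟨c, -, hc, s, hs, hact, hbit⟩
    exact ⟨certKS (n + 1) c.unpair.1, certKS_total _ _, ⟨s, hs⟩,
      (hc.agrees (q := ⟨s, hs⟩) (Nat.lt_succ_self n) hact).1 hbit⟩
  · rintro ⟨M, hM, q, h⟩
    exact exists_certifies h

/-! ### Primitive recursiveness of the search -/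

section Primrec

variable {α : Type*} [Primcodable α]

theorem Primrec.unpair_fst {f : α → ℕ} (hf : Primrec f) : Primrec fun a => (f a).unpair.1 :=
  Primrec.fst.comp (Primrec.unpair.comp hf)

theorem Primrec.unpair_snd {f : α → ℕ} (hf : Primrec f) : Primrec fun a => (f a).unpair.2 :=
  Primrec.snd.comp (Primrec.unpair.comp hf)

theorem Primrec.pair_nat {f g : α → ℕ} (hf : Primrec f) (hg : Primrec g) :
    Primrec fun a => Nat.pair (f a) (g a) :=
  Primrec₂.natPair.comp hf hg

theorem Primrec.two_pow {f : α → ℕ} (hf : Primrec f) : Primrec fun a => 2 ^ f a := by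
  have h : Primrec fun n : ℕ => 2 ^ n :=
    (Primrec.nat_rec₁ 1 (f := fun _ m => m * 2)
      (Primrec.nat_mul.comp Primrec.snd (Primrec.const 2)).to₂).of_eq fun n => by
        induction n with
        | zero => rfl
        | succ n ih => rw [pow_succ, ← ih]
  exact h.comp hf

theorem PrimrecPred.eq_nat {f g : α → ℕ} (hf : Primrec f) (hg : Primrec g) :
    PrimrecPred fun a => f a = g a :=
  Primrec.eq.comp hf hg

theorem PrimrecPred.testBit {f g : α → ℕ} (hf : Primrec f) (hg : Primrec g) :
    PrimrecPred fun a => (f a).testBit (g a) = true :=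
  (PrimrecPred.eq_nat (Primrec.nat_mod.comp (Primrec.nat_div.comp hf (Primrec.two_pow hg))
    (Primrec.const 2)) (Primrec.const 1)).of_eq fun a => by
      rw [Nat.testBit_eq_decide_div_mod_eq, decide_eq_true_iff]

theorem PrimrecPred.imp {p q : α → Prop} (hp : PrimrecPred p) (hq : PrimrecPred q) :
    PrimrecPred fun a => p a → q a :=
  (hp.not.or hq).of_eq fun _ => imp_iff_not_or.symm

theorem PrimrecPred.iff {p q : α → Prop} (hp : PrimrecPred p) (hq : PrimrecPred q) :
    PrimrecPred fun a => p a ↔ q a :=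
  ((hp.imp hq).and (hq.imp hp)).of_eq fun _ => iff_def.symm

theorem PrimrecPred.exists_lt_of {p : α → ℕ → Prop} {b : α → ℕ} (hb : Primrec b)
    (hp : PrimrecPred fun x : α × ℕ => p x.1 x.2) : PrimrecPred fun a => ∃ x < b a, p a x :=
  ((PrimrecRel.exists_mem_list (R := fun x a => p a x)
    (hp.comp (Primrec.pair Primrec.snd Primrec.fst))).comp
      (Primrec.list_range.comp hb) Primrec.id).of_eq (by simp)

theorem PrimrecPred.forall_lt_of {p : α → ℕ → Prop} {b : α → ℕ} (hb : Primrec b)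
    (hp : PrimrecPred fun x : α × ℕ => p x.1 x.2) : PrimrecPred fun a => ∀ x < b a, p a x :=
  ((PrimrecRel.forall_mem_list (R := fun x a => p a x)
    (hp.comp (Primrec.pair Primrec.snd Primrec.fst))).comp
      (Primrec.list_range.comp hb) Primrec.id).of_eq (by simp)

theorem getD_map_range {σ : Type*} (f : ℕ → σ) {k n : ℕ} (h : k < n) (d : σ) :
    ((List.range n).map f).getD k d = f k := by
  simp [h]

theorem primrec_linWeight : Primrec₂ linWeight := by
  have hlen : Primrec fun x : ℕ × List ℕ => x.2.length := Primrec.list_length.comp Primrec.snd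
  have hget {k : ℕ × List ℕ → ℕ} (hk : Primrec k) :
      Primrec fun x : ℕ × List ℕ => x.2.getD (k x) 0 :=
    (Primrec.list_getD 0).comp Primrec.snd hk
  refine Primrec.nat_strong_rec linWeight
    (g := fun t l => some (if l.length.unpair.1 = 0 then
      if t.testBit l.length.unpair.2.unpair.2 = true then l.length.unpair.2.unpair.1 else 0
      else l.getD l.length.unpair.2.unpair.1 0 + l.getD l.length.unpair.2.unpair.2 0)) ?_ ?_
  · exact Primrec.option_some.comp (Primrec.ite (PrimrecPred.eq_nat hlen.unpair_fst (.const 0))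
      (Primrec.ite (PrimrecPred.testBit Primrec.fst hlen.unpair_snd.unpair_snd)
        hlen.unpair_snd.unpair_fst (.const 0))
      (Primrec.nat_add.comp (hget hlen.unpair_snd.unpair_fst) (hget hlen.unpair_snd.unpair_snd)))
  · intro t n
    rw [linWeight, List.length_map, List.length_range]
    split_ifs with h0
    · rfl
    · rfl
    · rw [getD_map_range _ (unpair_snd_fst_lt h0), getD_map_range _ (unpair_snd_snd_lt h0)]

theorem primrec_atomicNil : Primrec atomicNil := by
  have h1 : Primrec fun x : ℕ => x.unpair.1 := Primrec.id.unpair_fst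
  have h2 : Primrec fun x : ℕ => x.unpair.2 := Primrec.id.unpair_snd
  exact Primrec.ite (PrimrecPred.eq_nat h1 (.const 0))
    (Primrec.nat_lt.comp (.const 0) h2).decide
    (Primrec.ite (PrimrecPred.eq_nat h1 (.const 1)) (.const true)
      ((Primrec.nat_le.comp h1 (.const 3)).and (PrimrecPred.eq_nat h2 (.const 0))).decide)

theorem primrec_constrNil : Primrec constrNil := by
  have hlen : Primrec fun x : ℕ × List Bool => x.2.length := Primrec.list_length.comp Primrec.snd
  have hget {k : ℕ × List Bool → ℕ} (hk : Primrec k) :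
      Primrec fun x : ℕ × List Bool => x.2.getD (k x) false :=
    (Primrec.list_getD false).comp Primrec.snd hk
  have h : Primrec₂ fun _ n : ℕ => constrNil n := by
    refine Primrec.nat_strong_rec (fun _ n : ℕ => constrNil n)
      (g := fun _ l => some (if l.length.unpair.1 = 0 then atomicNil l.length.unpair.2.unpair.2
        else if l.length.unpair.1 = 1 then
          l.getD l.length.unpair.2.unpair.1 false && l.getD l.length.unpair.2.unpair.2 false
        else !l.getD l.length.unpair.2 false)) ?_ ?_
    · exact Primrec.option_some.comp (Primrec.ite (PrimrecPred.eq_nat hlen.unpair_fst (.const 0))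
        (primrec_atomicNil.comp hlen.unpair_snd.unpair_snd)
        (Primrec.ite (PrimrecPred.eq_nat hlen.unpair_fst (.const 1))
          (Primrec.and.comp (hget hlen.unpair_snd.unpair_fst) (hget hlen.unpair_snd.unpair_snd))
          (Primrec.not.comp (hget hlen.unpair_snd))))
    · intro _ n
      rw [constrNil, List.length_map, List.length_range]
      split_ifs with h0
      · rfl
      · rw [getD_map_range _ (unpair_snd_fst_lt h0), getD_map_range _ (unpair_snd_snd_lt h0)]
      · rw [getD_map_range _ (unpair_snd_lt h0)]
  exact h.comp Primrec.id Primrec.id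

theorem primrec_atomicDeriv : Primrec₂ atomicDeriv := by
  have h1 : Primrec fun p : ℕ × ℕ => p.2.unpair.1 := Primrec.snd.unpair_fst
  have h2 : Primrec fun p : ℕ × ℕ => p.2.unpair.2 := Primrec.snd.unpair_snd
  exact Primrec.ite (Primrec.nat_le.comp Primrec.fst h2)
    (h1.pair_nat (Primrec.nat_sub.comp h2 Primrec.fst))
    (Primrec.ite (Primrec.nat_lt.comp h1 (.const 3)) (.const _) (.const _))

theorem primrec_constrDeriv : Primrec₂ constrDeriv := by
  have hlen : Primrec fun x : ℕ × List ℕ => x.2.length := Primrec.list_length.comp Primrec.snd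
  have hget {k : ℕ × List ℕ → ℕ} (hk : Primrec k) :
      Primrec fun x : ℕ × List ℕ => x.2.getD (k x) 0 :=
    (Primrec.list_getD 0).comp Primrec.snd hk
  refine Primrec.nat_strong_rec constrDeriv
    (g := fun t l => some (if l.length.unpair.1 = 0 then
      Nat.pair 0 (Nat.pair l.length.unpair.2.unpair.1
        (atomicDeriv (linWeight t l.length.unpair.2.unpair.1) l.length.unpair.2.unpair.2))
      else if l.length.unpair.1 = 1 then
        Nat.pair 1 (Nat.pair (l.getD l.length.unpair.2.unpair.1 0)
          (l.getD l.length.unpair.2.unpair.2 0))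
      else Nat.pair l.length.unpair.1 (l.getD l.length.unpair.2 0))) ?_ ?_
  · exact Primrec.option_some.comp (Primrec.ite (PrimrecPred.eq_nat hlen.unpair_fst (.const 0))
      ((Primrec.const 0).pair_nat (hlen.unpair_snd.unpair_fst.pair_nat
        (primrec_atomicDeriv.comp (primrec_linWeight.comp Primrec.fst hlen.unpair_snd.unpair_fst)
          hlen.unpair_snd.unpair_snd)))
      (Primrec.ite (PrimrecPred.eq_nat hlen.unpair_fst (.const 1))
        ((Primrec.const 1).pair_nat ((hget hlen.unpair_snd.unpair_fst).pair_nat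
          (hget hlen.unpair_snd.unpair_snd)))
        (hlen.unpair_fst.pair_nat (hget hlen.unpair_snd))))
  · intro t n
    rw [constrDeriv, List.length_map, List.length_range]
    split_ifs with h0
    · rfl
    · rw [getD_map_range _ (unpair_snd_fst_lt h0), getD_map_range _ (unpair_snd_snd_lt h0)]
    · rw [getD_map_range _ (unpair_snd_lt h0)]

variable {n s s' t N E L : α → ℕ}

theorem Primrec.evNext (hn : Primrec n) (ht : Primrec t) :
    Primrec fun a => _root_.evNext (n a) (t a) :=
  hn.unpair_fst.pair_nat (hn.unpair_snd.unpair_fst.pair_nat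
    ((primrec_constrDeriv.comp ht hn.unpair_snd.unpair_snd.unpair_fst).pair_nat
      hn.unpair_snd.unpair_snd.unpair_snd))

theorem PrimrecPred.evFul (hn : Primrec n) (ht : Primrec t) :
    PrimrecPred fun a => _root_.evFul (n a) (t a) = true :=
  ((PrimrecPred.testBit ht hn.unpair_snd.unpair_snd.unpair_snd).and
    (Primrec.primrecPred ((primrec_constrNil.comp
      hn.unpair_snd.unpair_snd.unpair_fst).of_eq fun _ => Bool.decide_eq_true.symm))).of_eq
    fun a => by simp [_root_.evFul]

theorem Primrec.stateBound (hN : Primrec N) : Primrec fun a => _root_.stateBound (N a) :=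
  hN.two_pow.pair_nat hN.two_pow

theorem Primrec.certBound (hn : Primrec n) : Primrec fun a => _root_.certBound (n a) :=
  have h := (Primrec.succ.comp hn).stateBound
  (h.pair_nat h).two_pow.pair_nat (h.pair_nat h).two_pow

theorem PrimrecPred.edge (hE : Primrec E) (hs : Primrec s) (hs' : Primrec s') :
    PrimrecPred fun a => _root_.edge (E a) (s a) (s' a) :=
  PrimrecPred.testBit hE (hs.pair_nat hs')

theorem PrimrecPred.active (hN : Primrec N) (hE : Primrec E) (hs : Primrec s) :
    PrimrecPred fun a => Active (N a) (E a) (s a) :=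
  PrimrecPred.exists_lt_of hN.stateBound
    (PrimrecPred.edge (hE.comp .fst) (hs.comp .fst) .snd)

theorem PrimrecPred.evStep_certRel {P : α → ℕ → Prop} (hN : Primrec N) (hE : Primrec E)
    (hn : Primrec n) (hs : Primrec s) (hP : PrimrecPred fun x : α × ℕ => P x.1 x.2) :
    PrimrecPred fun a => evStep (certRel (N a) (E a)) stateVal (P a) (n a) (s a) := by
  have hedge : PrimrecPred fun x : α × ℕ => _root_.edge (E x.1) (s x.1) x.2 :=
    PrimrecPred.edge (hE.comp .fst) (hs.comp .fst) .snd
  have heu := PrimrecPred.eq_nat hn.unpair_fst (.const 3)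
  refine ((PrimrecPred.evFul hn hs.unpair_fst).or
    ((PrimrecPred.testBit hs.unpair_fst hn.unpair_snd.unpair_fst).and
      ((heu.and (PrimrecPred.exists_lt_of (p := fun a s' => _root_.edge (E a) (s a) s' ∧ P a s')
          hN.stateBound (hedge.and hP))).or
        (heu.not.and (PrimrecPred.forall_lt_of
          (p := fun a s' => _root_.edge (E a) (s a) s' → P a s')
          hN.stateBound (hedge.imp hP)))))).of_eq fun a => ?_
  unfold evStep
  refine or_congr_right (and_congr_right fun _ => ?_)
  by_cases h : (n a).unpair.1 = 3 <;> simp [h, certRel, and_assoc]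

theorem PrimrecPred.localOK (hN : Primrec N) (hE : Primrec E) (hL : Primrec L) (hs : Primrec s)
    (hn : Primrec n) : PrimrecPred fun a => LocalOK (N a) (E a) (L a) (s a) (n a) := by
  have hv := hs.unpair_fst
  have hvn := PrimrecPred.testBit hv hn
  have h3 := Primrec.nat_le.comp (.const 3) hn.unpair_fst
  have hnext : Primrec fun x : α × ℕ => evNext (n x.1) (stateVal (s x.1)) :=
    (hn.evNext hv).comp .fst
  have hP : PrimrecPred fun x : α × ℕ =>
      (stateVal x.2).testBit (evNext (n x.1) (stateVal (s x.1))) = true :=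
    PrimrecPred.testBit Primrec.snd.unpair_fst hnext
  exact ((PrimrecPred.eq_nat hn.unpair_fst (.const 1)).imp (hvn.iff
      ((PrimrecPred.testBit hv hn.unpair_snd.unpair_fst).and
        (PrimrecPred.testBit hv hn.unpair_snd.unpair_snd)))).and
    (((PrimrecPred.eq_nat hn.unpair_fst (.const 2)).imp (hvn.iff
      (PrimrecPred.testBit hv hn.unpair_snd).not)).and
    ((h3.imp (hvn.iff (PrimrecPred.evStep_certRel hN hE hn hs hP))).and
    (h3.imp ((PrimrecPred.testBit hs.unpair_snd hn).imp (hvn.imp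
      (PrimrecPred.evStep_certRel hN hE hn hs (hP.and
        ((PrimrecPred.testBit Primrec.snd.unpair_snd hnext).and
          (PrimrecPred.edge (hL.comp .fst) .snd (hs.comp .fst))))))))))

theorem PrimrecPred.fullFocus (hN : Primrec N) (hs : Primrec s) :
    PrimrecPred fun a => FullFocus (N a) (s a) :=
  have hs' : Primrec fun x : α × ℕ => s x.1 := hs.comp .fst
  PrimrecPred.forall_lt_of hN ((Primrec.nat_le.comp (.const 3) Primrec.snd.unpair_fst).imp
    ((PrimrecPred.testBit hs'.unpair_fst .snd).imp (PrimrecPred.testBit hs'.unpair_snd .snd)))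

theorem PrimrecPred.isCert (hN : Primrec N) (hE : Primrec E) (hL : Primrec L) :
    PrimrecPred fun a => IsCert (N a) (E a) (L a) := by
  have hb := hN.stateBound
  have hN1 : Primrec fun x : α × ℕ => N x.1 := hN.comp .fst
  have hE1 : Primrec fun x : α × ℕ => E x.1 := hE.comp .fst
  have hL1 : Primrec fun x : α × ℕ => L x.1 := hL.comp .fst
  have hN2 : Primrec fun x : (α × ℕ) × ℕ => N x.1.1 := hN1.comp .fst
  have hE2 : Primrec fun x : (α × ℕ) × ℕ => E x.1.1 := hE1.comp .fst
  have hL2 : Primrec fun x : (α × ℕ) × ℕ => L x.1.1 := hL1.comp .fst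
  have hL3 : Primrec fun x : ((α × ℕ) × ℕ) × ℕ => L x.1.1.1 := hL2.comp .fst
  have hs2 : Primrec fun x : (α × ℕ) × ℕ => x.1.2 := Primrec.snd.comp .fst
  have hs3 : Primrec fun x : ((α × ℕ) × ℕ) × ℕ => x.1.1.2 := hs2.comp .fst
  have hs3' : Primrec fun x : ((α × ℕ) × ℕ) × ℕ => x.1.2 := Primrec.snd.comp .fst
  have hedge := PrimrecPred.edge hE2 hs2 .snd
  refine (PrimrecPred.forall_lt_of hb (PrimrecPred.forall_lt_of hN1.stateBound
      (hedge.imp (PrimrecPred.active hN2 hE2 .snd)))).and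
    ((PrimrecPred.forall_lt_of hb (PrimrecPred.edge hL1 .snd .snd).not).and
    ((PrimrecPred.forall_lt_of hb (PrimrecPred.forall_lt_of hN1.stateBound
      (PrimrecPred.forall_lt_of hN2.stateBound ((PrimrecPred.edge hL3 hs3 hs3').imp
        ((PrimrecPred.edge hL3 hs3' .snd).imp (PrimrecPred.edge hL3 hs3 .snd)))))).and
    ((PrimrecPred.forall_lt_of hb (PrimrecPred.forall_lt_of hN1.stateBound
      (hedge.imp ((PrimrecPred.edge hL2 .snd hs2).or (PrimrecPred.fullFocus hN2 .snd))))).and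
    (PrimrecPred.forall_lt_of hb ((PrimrecPred.active hN1 hE1 .snd).imp
      (PrimrecPred.forall_lt_of hN1 (PrimrecPred.localOK hN2 hE2 hL2 hs2 .snd)))))))

theorem primrecPred_exists_certifies : PrimrecPred fun n => ∃ c < certBound n, Certifies n c := by
  have hN : Primrec fun x : ℕ × ℕ => x.1 + 1 := Primrec.succ.comp .fst
  have hE : Primrec fun x : ℕ × ℕ => x.2.unpair.1 := Primrec.snd.unpair_fst
  refine PrimrecPred.exists_lt_of Primrec.id.certBound
    ((PrimrecPred.isCert hN hE Primrec.snd.unpair_snd).and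
      (PrimrecPred.exists_lt_of hN.stateBound
        ((PrimrecPred.active (hN.comp .fst) (hE.comp .fst) .snd).and
          (PrimrecPred.testBit Primrec.snd.unpair_fst (Primrec.fst.comp .fst)))))

end Primrec

/-- satisfiability of CCTLb is decidable: some computable
function decides, with respect to the natural encoding of formulas,
whether a CCTLb formula is satisfied at some state of some finite Kripke
structure. -/
theorem cctlb_sat_decidable :
    ∃ f : ℕ → Bool, Computable f ∧
      ∀ Φ : CForm,
        (f (encForm Φ) = true ↔
          ∃ (M : FinKS) (hM : M.Total) (q : Fin M.n),
            sat (M.toKripke hM) Φ q) := by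
  refine ⟨fun n => decide (∃ c < certBound n, Certifies n c),
    primrecPred_exists_certifies.decide.to_comp, fun Φ => ?_⟩
  rw [decide_eq_true_iff, satisfiable_iff, decForm_encForm]
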